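/- arXiv:1701.00293 — 4 statements merged into one kernel-verified Lean document; each statement's English description precedes it below -/
import Mathlib

section
/- Let a, b > 0 be real numbers and θ a real constant. Define s(t) = √(b/a) · cos(√(a·b)·log t + θ) / (t · sin(√(a·b)·log t + θ)), i.e. s(t) = √(b/a)·cot(√(a·b)·log t + θ)/t. Then at every t > 0 with sin(√(a·b)·log t + θ) ≠ 0, the function s is differentiable and satisfies the Riccati equation s'(t) = −a·s(t)² − s(t)/t − b/t². -/
/-- Lemma 4.3 (Riccati equations): for `a, b > 0` and any constant `θ`, the
function `s(t) = √(b/a)·cot(√(ab) log t + θ)/t` is differentiable and satisfies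
`s'(t) = −a s(t)² − s(t)/t − b/t²` at every `t > 0` with
`sin(√(ab) log t + θ) ≠ 0`. -/
theorem stmt6 (a b θ : ℝ) (ha : 0 < a) (hb : 0 < b)
    (s : ℝ → ℝ)
    (hs : ∀ t : ℝ, s t =
      Real.sqrt (b / a) * Real.cos (Real.sqrt (a * b) * Real.log t + θ)
        / (t * Real.sin (Real.sqrt (a * b) * Real.log t + θ))) :
    ∀ t : ℝ, 0 < t → Real.sin (Real.sqrt (a * b) * Real.log t + θ) ≠ 0 →
      DifferentiableAt ℝ s t ∧
      deriv s t = -a * s t ^ 2 - s t / t - b / t ^ 2 := by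
  intro t ht hS
  have hRw : √(b / a) * √(a * b) = b := by
    rw [← Real.sqrt_mul (by positivity), show b / a * (a * b) = b ^ 2 by field_simp,
      Real.sqrt_sq hb.le]
  have hR : a * √(b / a) ^ 2 = b := by
    rw [Real.sq_sqrt (by positivity)]
    field_simp
  have hphase : HasDerivAt (fun t => √(a * b) * Real.log t + θ) (√(a * b) * t⁻¹) t :=
    ((Real.hasDerivAt_log ht.ne').const_mul _).add_const θ
  have hderiv := (hphase.cos.const_mul √(b / a)).fun_div
    ((hasDerivAt_id' t).fun_mul hphase.sin) (mul_ne_zero ht.ne' hS)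
  rw [← funext hs] at hderiv
  refine ⟨hderiv.differentiableAt, ?_⟩
  rw [hderiv.deriv, hs t]
  generalize Real.sin (√(a * b) * Real.log t + θ) = S at *
  generalize Real.cos (√(a * b) * Real.log t + θ) = C at *
  generalize √(b / a) = R at *
  generalize √(a * b) = w at *
  field_simp
  linear_combination (-S ^ 2 - C ^ 2) * hRw + C ^ 2 * hR
end

section
/- Let α > 0 and 0 < r₁ ≤ r₂ be real numbers, and let f : ℝ × ℝ → ℝ be a C² function which is 2π-periodic in its second variable: f(r, φ + 2π) = f(r, φ). Suppose that for every r ∈ [r₁, r₂] and every φ ∈ ℝ, (α/4)·(∂f/∂r)² + (α/(4r²))·(∂f/∂φ)² + α/r² − (α/r²)·(∂f/∂φ) + (1/4)·∂²f/∂r² + (1/(4r))·∂f/∂r + (1/(4r²))·∂²f/∂φ² ≤ 0. Define F(r) = (1/(2π))·∫₀^{2π} f(r, φ) dφ. Then F is twice differentiable on [r₁, r₂] and for every r ∈ [r₁, r₂], F''(r) + α·F'(r)² + F'(r)/r + 4α/r² ≤ 0. -/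
open Real Set

/-- The partial derivative, in the first variable, of a jointly differentiable function of two
variables. -/
lemma hasDerivAt_uncurry_left {g : ℝ → ℝ → ℝ} (hg : Differentiable ℝ (Function.uncurry g))
    (r φ : ℝ) :
    HasDerivAt (fun r' => g r' φ) (fderiv ℝ (Function.uncurry g) (r, φ) (1, 0)) r :=
  HasFDerivAt.comp_hasDerivAt (f := fun r' : ℝ => (r', φ)) r (hg (r, φ)).hasFDerivAt
    ((hasDerivAt_id r).prodMk (hasDerivAt_const r φ))

/-- The first partial derivative of a `C^(n+1)` function is `C^n`. -/
lemma contDiff_uncurry_deriv_left {g : ℝ → ℝ → ℝ} {m n : WithTop ℕ∞}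
    (hg : ContDiff ℝ m (Function.uncurry g)) (hnm : n + 1 ≤ m) :
    ContDiff ℝ n (Function.uncurry fun r φ => deriv (fun r' => g r' φ) r) := by
  have hd : Differentiable ℝ (Function.uncurry g) :=
    hg.differentiable (by rintro rfl; simp at hnm)
  have h : (Function.uncurry fun r φ => deriv (fun r' => g r' φ) r) =
      fun p => fderiv ℝ (Function.uncurry g) p (1, 0) := by
    ext ⟨r, φ⟩
    exact (hasDerivAt_uncurry_left hd r φ).deriv
  rw [h]
  exact (hg.fderiv_right hnm).clm_apply contDiff_const

/-- Differentiation under the integral sign for a jointly `C¹` integrand. -/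
lemma hasDerivAt_intervalIntegral_of_contDiff {g : ℝ → ℝ → ℝ}
    (hg : ContDiff ℝ 1 (Function.uncurry g)) (a b r : ℝ) :
    HasDerivAt (fun r' => ∫ φ in a..b, g r' φ)
      (∫ φ in a..b, deriv (fun r' => g r' φ) r) r := by
  have hd : Differentiable ℝ (Function.uncurry g) := hg.differentiable one_ne_zero
  have hc : Continuous (Function.uncurry fun r φ => deriv (fun r' => g r' φ) r) :=
    (contDiff_uncurry_deriv_left (n := 0) hg (by norm_num)).continuous
  obtain ⟨C, hC⟩ := ((isCompact_Icc (a := r - 1) (b := r + 1)).prod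
    (isCompact_uIcc (a := a) (b := b))).exists_bound_of_continuousOn hc.continuousOn
  have hsec : ∀ r', Continuous (g r') := fun r' => hg.continuous.comp (Continuous.prodMk_right r')
  refine (intervalIntegral.hasDerivAt_integral_of_dominated_loc_of_deriv_le
    (F' := fun r' φ => deriv (fun r'' => g r'' φ) r') (bound := fun _ => C)
    (Icc_mem_nhds (sub_one_lt r) (lt_add_one r)) ?_ ?_ ?_ ?_ ?_ ?_).2
  · exact Filter.Eventually.of_forall fun r' => (hsec r').aestronglyMeasurable
  · exact (hsec r).intervalIntegrable a b
  · exact (hc.comp (Continuous.prodMk_right r)).aestronglyMeasurable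
  · exact Filter.Eventually.of_forall fun φ hφ r' hr' =>
      hC (r', φ) ⟨hr', uIoc_subset_uIcc hφ⟩
  · exact intervalIntegrable_const
  · exact Filter.Eventually.of_forall fun φ _ r' _ =>
      (hasDerivAt_uncurry_left hd r' φ).differentiableAt.hasDerivAt

/-- The derivative of a periodic function is periodic. -/
lemma Function.Periodic.deriv_real {h : ℝ → ℝ} {c : ℝ} (hh : Function.Periodic h c) :
    Function.Periodic (deriv h) c := fun x => by
  rw [← deriv_comp_add_const, show (fun y => h (y + c)) = h from funext hh]

/-- The derivative of a `C¹` periodic function integrates to zero over a period. -/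
lemma intervalIntegral_deriv_eq_zero_of_periodic {h : ℝ → ℝ} {c : ℝ} (hd : ContDiff ℝ 1 h)
    (hh : Function.Periodic h c) : ∫ x in (0 : ℝ)..c, deriv h x = 0 := by
  rw [intervalIntegral.integral_deriv_eq_sub (fun x _ => hd.differentiable one_ne_zero x)
    ((hd.continuous_deriv le_rfl).intervalIntegrable _ _), hh.eq, sub_self]

/-- The averaging step in Section 4: if a `C²` function `f(r, φ)`, `2π`-periodic
in `φ`, satisfies the partial differential inequality
`(α/4) f_r² + (α/(4r²)) f_φ² + α/r² − (α/r²) f_φ + (1/4) f_rr + (1/(4r)) f_r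
  + (1/(4r²)) f_φφ ≤ 0`
for `r ∈ [r₁, r₂]` and all `φ`, then the circular average
`F(r) = (1/(2π)) ∫₀^{2π} f(r, φ) dφ` is twice differentiable on `[r₁, r₂]` and
satisfies `F'' + α F'² + F'/r + 4α/r² ≤ 0` there. -/
theorem stmt7 (α r₁ r₂ : ℝ) (hα : 0 < α) (hr₁ : 0 < r₁) (hr₁₂ : r₁ ≤ r₂)
    (f : ℝ → ℝ → ℝ)
    (hf : ContDiff ℝ 2 (Function.uncurry f))
    (hper : ∀ r φ : ℝ, f r (φ + 2 * π) = f r φ)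
    (hineq : ∀ r ∈ Icc r₁ r₂, ∀ φ : ℝ,
      α / 4 * (deriv (fun r' => f r' φ) r) ^ 2
        + α / (4 * r ^ 2) * (deriv (f r) φ) ^ 2
        + α / r ^ 2
        - α / r ^ 2 * deriv (f r) φ
        + 1 / 4 * deriv (fun r' => deriv (fun r'' => f r'' φ) r') r
        + 1 / (4 * r) * deriv (fun r' => f r' φ) r
        + 1 / (4 * r ^ 2) * deriv (deriv (f r)) φ ≤ 0)
    (F : ℝ → ℝ)
    (hF : ∀ r : ℝ, F r = (1 / (2 * π)) * ∫ φ in (0:ℝ)..(2 * π), f r φ) :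
    (∀ r ∈ Icc r₁ r₂, DifferentiableAt ℝ F r ∧ DifferentiableAt ℝ (deriv F) r) ∧
    ∀ r ∈ Icc r₁ r₂,
      deriv (deriv F) r + α * (deriv F r) ^ 2 + deriv F r / r + 4 * α / r ^ 2 ≤ 0 := by
  have hπ : (0 : ℝ) < 2 * π := by positivity
  have hf1 : ContDiff ℝ 1 (Function.uncurry f) := hf.of_le (by norm_num)
  have hfr : ContDiff ℝ 1 (Function.uncurry fun r φ => deriv (fun r' => f r' φ) r) :=
    contDiff_uncurry_deriv_left hf (by norm_num)
  have hfrr : Continuous (Function.uncurry fun r φ =>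
      deriv (fun r' => deriv (fun r'' => f r'' φ) r') r) :=
    (contDiff_uncurry_deriv_left (n := 0) hfr (by norm_num)).continuous
  have hF1 : ∀ r, HasDerivAt F
      (1 / (2 * π) * ∫ φ in (0 : ℝ)..(2 * π), deriv (fun r' => f r' φ) r) r := fun r => by
    rw [funext hF]
    exact (hasDerivAt_intervalIntegral_of_contDiff hf1 _ _ r).const_mul _
  have hdF : deriv F = fun r =>
      1 / (2 * π) * ∫ φ in (0 : ℝ)..(2 * π), deriv (fun r' => f r' φ) r :=
    funext fun r => (hF1 r).deriv
  have hF2 : ∀ r, HasDerivAt (deriv F) (1 / (2 * π) *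
      ∫ φ in (0 : ℝ)..(2 * π), deriv (fun r' => deriv (fun r'' => f r'' φ) r') r) r := fun r => by
    rw [hdF]
    exact (hasDerivAt_intervalIntegral_of_contDiff hfr _ _ r).const_mul _
  refine ⟨fun r _ => ⟨(hF1 r).differentiableAt, (hF2 r).differentiableAt⟩, fun r hr => ?_⟩
  have hr0 : 0 < r := hr₁.trans_le hr.1
  have hsec : ContDiff ℝ 2 (f r) := hf.comp (contDiff_prodMk_right r)
  have hsec' : ContDiff ℝ 1 (deriv (f r)) := by
    have h : ContDiff ℝ (1 + 1) (f r) := by simpa [one_add_one_eq_two] using hsec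
    exact (contDiff_succ_iff_deriv.1 h).2.2
  have hp : Function.Periodic (f r) (2 * π) := hper r
  have i1 : IntervalIntegrable (fun φ => deriv (fun r' => f r' φ) r) MeasureTheory.volume
      0 (2 * π) :=
    (hfr.continuous.comp (Continuous.prodMk_right r)).intervalIntegrable _ _
  have i2 : IntervalIntegrable (fun φ => deriv (fun r' => deriv (fun r'' => f r'' φ) r') r)
      MeasureTheory.volume 0 (2 * π) :=
    (hfrr.comp (Continuous.prodMk_right r)).intervalIntegrable _ _
  have i3 : IntervalIntegrable (deriv (f r)) MeasureTheory.volume 0 (2 * π) :=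
    hsec'.continuous.intervalIntegrable _ _
  have i4 : IntervalIntegrable (deriv (deriv (f r))) MeasureTheory.volume 0 (2 * π) :=
    (hsec'.continuous_deriv le_rfl).intervalIntegrable _ _
  have e1 : ∫ φ in (0 : ℝ)..(2 * π), deriv (fun r' => f r' φ) r = 2 * π * deriv F r := by
    rw [hdF]; field_simp
  have e2 : ∫ φ in (0 : ℝ)..(2 * π), deriv (fun r' => deriv (fun r'' => f r'' φ) r') r
      = 2 * π * deriv (deriv F) r := by
    rw [(hF2 r).deriv]; field_simp
  have e3 := intervalIntegral_deriv_eq_zero_of_periodic (hsec.of_le (by norm_num)) hp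
  have e4 := intervalIntegral_deriv_eq_zero_of_periodic hsec' hp.deriv_real
  generalize deriv F r = A at *
  generalize deriv (deriv F) r = B at *
  -- The quadratic term is bounded below by its tangent line at the mean `A`.
  have hpt : ∀ φ : ℝ, (4 * α / r ^ 2 - α * A ^ 2)
      + (2 * α * A + 1 / r) * deriv (fun r' => f r' φ) r
      + deriv (fun r' => deriv (fun r'' => f r'' φ) r') r
      + (-(4 * α / r ^ 2)) * deriv (f r) φ + 1 / r ^ 2 * deriv (deriv (f r)) φ ≤ 0 := fun φ => by
    have h := hineq r hr φ
    have h1 : 0 ≤ α * (deriv (fun r' => f r' φ) r - A) ^ 2 := by positivity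
    have h2 : 0 ≤ α / (4 * r ^ 2) * (deriv (f r) φ) ^ 2 := by positivity
    have h3 : 1 / (4 * r) = 1 / 4 * (1 / r) := by field_simp
    have h4 : 1 / (4 * r ^ 2) = 1 / 4 * (1 / r ^ 2) := by field_simp
    have h5 : 4 * α / r ^ 2 = 4 * (α / r ^ 2) := by ring
    rw [h3, h4] at h
    rw [h5]
    linarith
  have hint := intervalIntegral.integral_nonneg (μ := MeasureTheory.volume) hπ.le
    fun φ _ => neg_nonneg.2 (hpt φ)
  have j1 := (intervalIntegrable_const (μ := MeasureTheory.volume) (a := 0) (b := 2 * π)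
    (c := 4 * α / r ^ 2 - α * A ^ 2)).add (i1.const_mul (2 * α * A + 1 / r))
  have j2 := j1.add i2
  have j3 := j2.add (i3.const_mul (-(4 * α / r ^ 2)))
  rw [intervalIntegral.integral_neg,
    intervalIntegral.integral_add j3 (i4.const_mul _),
    intervalIntegral.integral_add j2 (i3.const_mul _),
    intervalIntegral.integral_add j1 i2,
    intervalIntegral.integral_add intervalIntegrable_const (i1.const_mul _)] at hint
  simp only [intervalIntegral.integral_const_mul, intervalIntegral.integral_const, e1, e2, e3, e4,
    smul_eq_mul] at hint
  refine nonpos_of_mul_nonpos_right (a := 2 * π) ?_ hπ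
  have h : A / r = 1 / r * A := by ring
  rw [h]
  linarith
end

section
/- Let β > π/2 and α > 0 be real numbers. Suppose s : ℝ → ℝ is differentiable on the closed interval [e^{π/4 − β/2}, e^{β/2 − π/4}] and satisfies the differential inequality s'(r) + α·s(r)² + s(r)/r + 4α/r² ≤ 0 for every r in this interval. Then α < π/(2β − π). -/
open Real Set

/-- If `s' + α s² + s/r + 4α/r² ≤ 0` on a set of positive reals, then `arctan (r s / 2) + 2α log r`
has nonpositive derivative there. -/
lemma exists_hasDerivAt_arctan_add_log_nonpos {α r : ℝ} {s : ℝ → ℝ} (hr : 0 < r)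
    (hs : DifferentiableAt ℝ s r)
    (h : deriv s r + α * s r ^ 2 + s r / r + 4 * α / r ^ 2 ≤ 0) :
    ∃ d ≤ 0, HasDerivAt (fun x => Real.arctan (x * s x / 2) + 2 * α * Real.log x) d r := by
  refine ⟨_, ?_, ((((hasDerivAt_id r).mul hs.hasDerivAt).div_const 2).arctan).add
    ((Real.hasDerivAt_log hr.ne').const_mul (2 * α))⟩
  have hmul : (deriv s r + α * s r ^ 2 + s r / r + 4 * α / r ^ 2) * r ^ 2 ≤ 0 :=
    mul_nonpos_of_nonpos_of_nonneg h (sq_nonneg r)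
  have hpos : 0 < 1 + (r * s r / 2) ^ 2 := by positivity
  have key : 1 / (1 + (r * s r / 2) ^ 2) * ((1 * s r + r * deriv s r) / 2) + 2 * α * r⁻¹ =
      (deriv s r + α * s r ^ 2 + s r / r + 4 * α / r ^ 2) * r ^ 2 /
        (2 * r * (1 + (r * s r / 2) ^ 2)) := by
    field_simp
    ring
  have hle := div_nonpos_of_nonpos_of_nonneg hmul
    (by positivity : 0 ≤ 2 * r * (1 + (r * s r / 2) ^ 2))
  rw [← key] at hle
  simpa using hle

/-- The comparison step in Theorem 4.5: if `s` is differentiable on the interval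
`[e^{π/4 − β/2}, e^{β/2 − π/4}]` and satisfies
`s' + α s² + s/r + 4α/r² ≤ 0` there, then `α < π/(2β − π)`. -/
theorem stmt8 (β α : ℝ) (hβ : π / 2 < β) (hα : 0 < α)
    (s : ℝ → ℝ)
    (hdiff : ∀ r ∈ Icc (Real.exp (π / 4 - β / 2)) (Real.exp (β / 2 - π / 4)),
      DifferentiableAt ℝ s r)
    (hineq : ∀ r ∈ Icc (Real.exp (π / 4 - β / 2)) (Real.exp (β / 2 - π / 4)),
      deriv s r + α * s r ^ 2 + s r / r + 4 * α / r ^ 2 ≤ 0) :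
    α < π / (2 * β - π) := by
  have hderiv : ∀ r ∈ Icc (Real.exp (π / 4 - β / 2)) (Real.exp (β / 2 - π / 4)), ∃ d ≤ 0,
      HasDerivAt (fun x => Real.arctan (x * s x / 2) + 2 * α * Real.log x) d r := fun r hr =>
    exists_hasDerivAt_arctan_add_log_nonpos ((Real.exp_pos _).trans_le hr.1) (hdiff r hr)
      (hineq r hr)
  have hanti : AntitoneOn (fun x => Real.arctan (x * s x / 2) + 2 * α * Real.log x)
      (Icc (Real.exp (π / 4 - β / 2)) (Real.exp (β / 2 - π / 4))) := by
    refine antitoneOn_of_deriv_nonpos (convex_Icc _ _) (fun r hr => ?_) (fun r hr => ?_)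
      (fun r hr => ?_)
    · obtain ⟨d, -, hd⟩ := hderiv r hr
      exact hd.continuousAt.continuousWithinAt
    · obtain ⟨d, -, hd⟩ := hderiv r (interior_subset hr)
      exact hd.differentiableAt.differentiableWithinAt
    · obtain ⟨d, hd0, hd⟩ := hderiv r (interior_subset hr)
      exact hd.deriv.trans_le hd0
  have hle : Real.exp (π / 4 - β / 2) ≤ Real.exp (β / 2 - π / 4) :=
    Real.exp_le_exp.2 (by linarith)
  have hends := hanti (left_mem_Icc.2 hle) (right_mem_Icc.2 hle) hle
  simp only [Real.log_exp] at hends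
  have hlow := Real.neg_pi_div_two_lt_arctan
    (Real.exp (β / 2 - π / 4) * s (Real.exp (β / 2 - π / 4)) / 2)
  have hupp := Real.arctan_lt_pi_div_two
    (Real.exp (π / 4 - β / 2) * s (Real.exp (π / 4 - β / 2)) / 2)
  rw [lt_div_iff₀ (by linarith)]
  linarith
end

section
/- Let β > π/2 and let α be a real number with 0 < α < π/(2β − π). Then for every r ∈ [e^{π/4 − β/2}, e^{β/2 − π/4}] one has 0 < 2α·log r + π/2 < π (so that sin(2α·log r + π/2) > 0), and the function s(r) = 2·cos(2α·log r + π/2)/(r·sin(2α·log r + π/2)), i.e. s(r) = 2·cot(2α·log r + π/2)/r, is differentiable at every such r and satisfies s'(r) + α·s(r)² + s(r)/r + 4α/r² = 0 there. -/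
open Real Set

/-- The sharpness construction in Theorem 4.5: for `β > π/2` and
`0 < α < π/(2β − π)`, on the interval `[e^{π/4 − β/2}, e^{β/2 − π/4}]` one has
`0 < 2α log r + π/2 < π` (so the sine is positive), and the function
`s(r) = 2 cot(2α log r + π/2)/r` is differentiable and satisfies
`s' + α s² + s/r + 4α/r² = 0` there. -/
theorem stmt9 (β α : ℝ) (hβ : π / 2 < β) (hα : 0 < α)
    (hα' : α < π / (2 * β - π))
    (s : ℝ → ℝ)
    (hs : ∀ r : ℝ, s r =
      2 * Real.cos (2 * α * Real.log r + π / 2)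
        / (r * Real.sin (2 * α * Real.log r + π / 2))) :
    ∀ r ∈ Icc (Real.exp (π / 4 - β / 2)) (Real.exp (β / 2 - π / 4)),
      (0 < 2 * α * Real.log r + π / 2 ∧ 2 * α * Real.log r + π / 2 < π) ∧
      0 < Real.sin (2 * α * Real.log r + π / 2) ∧
      DifferentiableAt ℝ s r ∧
      deriv s r + α * s r ^ 2 + s r / r + 4 * α / r ^ 2 = 0 := by
  rintro r ⟨hr₁, hr₂⟩
  have hr : 0 < r := (Real.exp_pos _).trans_le hr₁
  have hl₁ : π / 4 - β / 2 ≤ Real.log r := (Real.le_log_iff_exp_le hr).2 hr₁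
  have hl₂ : Real.log r ≤ β / 2 - π / 4 := (Real.log_le_iff_le_exp hr).2 hr₂
  have hαβ : α * (2 * β - π) < π := (lt_div_iff₀ (by linarith)).1 hα'
  have hθ₁ : 0 < 2 * α * Real.log r + π / 2 := by
    linarith [mul_le_mul_of_nonneg_left hl₁ hα.le]
  have hθ₂ : 2 * α * Real.log r + π / 2 < π := by
    linarith [mul_le_mul_of_nonneg_left hl₂ hα.le]
  have hsin := Real.sin_pos_of_pos_of_lt_pi hθ₁ hθ₂
  have hθ : HasDerivAt (fun x => 2 * α * Real.log x + π / 2) (2 * α * r⁻¹) r :=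
    ((Real.hasDerivAt_log hr.ne').const_mul (2 * α)).add_const (π / 2)
  have hderiv := (hθ.cos.const_mul 2).fun_div ((hasDerivAt_id' r).fun_mul hθ.sin)
    (mul_pos hr hsin).ne'
  rw [← funext hs] at hderiv
  refine ⟨⟨hθ₁, hθ₂⟩, hsin, hderiv.differentiableAt, ?_⟩
  rw [hderiv.deriv, hs r]
  generalize Real.sin (2 * α * Real.log r + π / 2) = S at hsin ⊢
  generalize Real.cos (2 * α * Real.log r + π / 2) = C
  have hr' := hr.ne'
  have hS := hsin.ne'
  field_simp
  ring
end
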